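/- For every finite nonempty Λ ⊆ V and every ρ > 0, inf{ I_E(p) + ρ J_V(p) : p ∈ 𝒫(V), supp(p) ⊆ Λ } = − sup{ λ_Λ(q; G) : q : Λ → ℝ, Σ_{x ∈ Λ} e^{q(x)/ρ} ≤ 1 }. -/

import Mathlib

open scoped ENNReal BigOperators

/-- degree of a vertex (cardinality of the neighbour set) -/
noncomputable def degR {V : Type*} (G : SimpleGraph V) (x : V) : ℝ :=
  ((G.neighborSet x).ncard : ℝ)

/-- normalised Laplacian -/
noncomputable def lapl {V : Type*} (G : SimpleGraph V) (f : V → ℝ) (x : V) : ℝ :=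
  (1 / degR G x) * ∑ᶠ y ∈ G.neighborSet x, (f y - f x)

/-- degree-weighted inner product -/
noncomputable def dInner {V : Type*} (G : SimpleGraph V) (φ ψ : V → ℝ) : ℝ :=
  ∑ᶠ x, degR G x * φ x * ψ x

/-- principal Dirichlet eigenvalue of `Δ + q` on the finite set `Λ`,
via the Rayleigh–Ritz formula -/
noncomputable def pev {V : Type*} (G : SimpleGraph V) (Λ : Finset V) (q : V → ℝ) : ℝ :=
  sSup { r | ∃ φ : V → ℝ, (∀ x ∉ Λ, φ x = 0) ∧ dInner G φ φ = 1 ∧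
    r = ∑ x ∈ Λ, degR G x * (lapl G φ x + q x * φ x) * φ x }

/-- the functional `I_E(p)`, with values in `[0,∞]` -/
noncomputable def IE {V : Type*} (G : SimpleGraph V) (p : V → ℝ) : ℝ≥0∞ :=
  ∑' e : G.edgeSet,
    ENNReal.ofReal
      (Sym2.lift ⟨fun x y => (Real.sqrt (p x / degR G x) - Real.sqrt (p y / degR G y)) ^ 2,
        fun x y => by ring⟩ e.1)

/-- the entropy functional `J_V(p)`, with values in `[0,∞]`
(the convention `0 · log 0 = 0` is automatic since `Real.log 0 = 0`) -/
noncomputable def JV {V : Type*} (p : V → ℝ) : ℝ≥0∞ :=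
  ∑' x, ENNReal.ofReal (-(p x * Real.log (p x)))

/-- `p` is a probability measure on `V` -/
def IsProb {V : Type*} (p : V → ℝ) : Prop :=
  (∀ x, 0 ≤ p x) ∧ (∀ x, p x ≤ 1) ∧ HasSum p 1

/-- squared increment of `φ` along an unordered pair -/
def sqIncr {V : Type*} (φ : V → ℝ) : Sym2 V → ℝ :=
  Sym2.lift ⟨fun x y => (φ x - φ y) ^ 2, fun x y => by ring⟩

@[simp]
theorem sqIncr_mk {V : Type*} (φ : V → ℝ) (x y : V) : sqIncr φ s(x, y) = (φ x - φ y) ^ 2 := rfl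

theorem sqIncr_nonneg {V : Type*} (φ : V → ℝ) (e : Sym2 V) : 0 ≤ sqIncr φ e := by
  induction e with
  | _ x y => exact sq_nonneg _

theorem sqIncr_abs_le {V : Type*} (φ : V → ℝ) (e : Sym2 V) :
    sqIncr (fun x => |φ x|) e ≤ sqIncr φ e := by
  induction e with
  | _ x y => exact sq_le_sq.2 (abs_abs_sub_abs_le _ _)

/-- Dirichlet energy of `φ` over the edges with both endpoints in `W` -/
noncomputable def energy {V : Type*} (G : SimpleGraph V) (W : Finset V) (φ : V → ℝ) : ℝ :=
  ∑ e ∈ W.sym2, G.edgeSet.indicator (sqIncr φ) e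

theorem energy_nonneg {V : Type*} (G : SimpleGraph V) (W : Finset V) (φ : V → ℝ) :
    0 ≤ energy G W φ :=
  Finset.sum_nonneg fun _ _ => Set.indicator_nonneg (fun _ _ => sqIncr_nonneg _ _) _

theorem energy_abs_le {V : Type*} (G : SimpleGraph V) (W : Finset V) (φ : V → ℝ) :
    energy G W (fun x => |φ x|) ≤ energy G W φ :=
  Finset.sum_le_sum fun _ _ => Set.indicator_le_indicator (sqIncr_abs_le φ _)

theorem two_mul_sum_sym2 {V : Type*} (W : Finset V) (h : Sym2 V → ℝ)
    (hdiag : ∀ x, h s(x, x) = 0) :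
    2 * ∑ e ∈ W.sym2, h e = ∑ x ∈ W, ∑ y ∈ W, h s(x, y) := by
  classical
  let _ : LinearOrder V := linearOrderOfSTO WellOrderingRel
  have h1 : ∑ e ∈ W.sym2, h e = ∑ x ∈ W, ∑ y ∈ W, if x < y then h s(x, y) else 0 := by
    rw [← Finset.sum_product' W W (fun x y => if x < y then h s(x, y) else 0),
      ← Finset.sum_filter, ← Finset.sum_filter_of_ne (p := fun e : Sym2 V => ¬ e.IsDiag),
      Finset.sum_sym2_filter_not_isDiag]
    · refine Finset.sum_congr ?_ fun _ _ => rfl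
      ext ⟨x, y⟩
      simp only [Finset.mem_filter, Finset.mem_offDiag, Finset.mem_product]
      exact ⟨fun ⟨⟨a, b, _⟩, c⟩ => ⟨⟨a, b⟩, c⟩, fun ⟨⟨a, b⟩, c⟩ => ⟨⟨a, b, c.ne⟩, c⟩⟩
    · intro e _ he hd
      induction e with
      | _ x y =>
        obtain rfl : x = y := hd
        exact he (hdiag x)
  have h2 : ∑ e ∈ W.sym2, h e = ∑ x ∈ W, ∑ y ∈ W, if y < x then h s(x, y) else 0 := by
    rw [h1, Finset.sum_comm]
    simp only [Sym2.eq_swap]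
  rw [two_mul]
  nth_rewrite 1 [h1]
  rw [h2, ← Finset.sum_add_distrib]
  refine Finset.sum_congr rfl fun x _ => ?_
  rw [← Finset.sum_add_distrib]
  refine Finset.sum_congr rfl fun y _ => ?_
  rcases lt_trichotomy x y with hxy | rfl | hxy
  · simp [hxy, hxy.not_gt]
  · simp [hdiag]
  · simp [hxy, hxy.not_gt]

theorem degR_pos {V : Type*} {G : SimpleGraph V} {x : V} (hf : (G.neighborSet x).Finite)
    (hne : (G.neighborSet x).Nonempty) : 0 < degR G x := by
  unfold degR
  exact_mod_cast (Set.ncard_pos hf).2 hne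

theorem IE_eq_energy {V : Type*} (G : SimpleGraph V) {Λ W : Finset V} (hΛW : Λ ⊆ W)
    (hW : ∀ x ∈ Λ, ∀ y, G.Adj x y → y ∈ W) {p : V → ℝ} (hp : ∀ x ∉ Λ, p x = 0) :
    IE G p = ENNReal.ofReal (energy G W fun x => √(p x / degR G x)) := by
  set φ : V → ℝ := fun x => √(p x / degR G x) with hφ
  have hφ0 : ∀ x ∉ Λ, φ x = 0 := fun x hx => by simp [hφ, hp x hx]
  have h1 : IE G p = ∑' e, G.edgeSet.indicator (fun e => ENNReal.ofReal (sqIncr φ e)) e :=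
    tsum_subtype G.edgeSet fun e => ENNReal.ofReal (sqIncr φ e)
  rw [h1, energy, ENNReal.ofReal_sum_of_nonneg
    fun _ _ => Set.indicator_nonneg (fun _ _ => sqIncr_nonneg _ _) _, tsum_eq_sum (s := W.sym2)]
  · refine Finset.sum_congr rfl fun e _ => ?_
    by_cases he : e ∈ G.edgeSet <;> simp [he]
  · intro e he
    by_cases hG : e ∈ G.edgeSet
    · rw [Set.indicator_of_mem hG]
      induction e with
      | _ x y =>
        have hadj : G.Adj x y := hG
        have hx : x ∉ Λ := fun hx => he (Finset.mk_mem_sym2_iff.2 ⟨hΛW hx, hW x hx y hadj⟩)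
        have hy : y ∉ Λ := fun hy => he (Finset.mk_mem_sym2_iff.2 ⟨hW y hy x hadj.symm, hΛW hy⟩)
        simp [hφ0 x hx, hφ0 y hy]
    · exact Set.indicator_of_notMem hG _

open Classical in
theorem sum_lapl_mul_self {V : Type*} (G : SimpleGraph V)
    (hlf : ∀ x, (G.neighborSet x).Finite) (hdeg : ∀ x, (G.neighborSet x).Nonempty)
    {Λ W : Finset V} (hΛW : Λ ⊆ W) (hW : ∀ x ∈ Λ, ∀ y, G.Adj x y → y ∈ W)
    {φ : V → ℝ} (hφ : ∀ x ∉ Λ, φ x = 0) :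
    ∑ x ∈ Λ, degR G x * lapl G φ x * φ x = - energy G W φ := by
  have h1 : ∑ x ∈ Λ, degR G x * lapl G φ x * φ x =
      ∑ x ∈ W, ∑ y ∈ W, if G.Adj x y then (φ y - φ x) * φ x else 0 := by
    rw [← Finset.sum_subset hΛW]
    · refine Finset.sum_congr rfl fun x hx => ?_
      have hd := (degR_pos (hlf x) (hdeg x)).ne'
      rw [lapl, ← mul_assoc, mul_one_div_cancel hd, one_mul,
        finsum_mem_eq_finite_toFinset_sum _ (hlf x), Finset.sum_mul, ← Finset.sum_filter]
      refine Finset.sum_congr ?_ fun _ _ => rfl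
      ext y
      simp only [Set.Finite.mem_toFinset, SimpleGraph.mem_neighborSet, Finset.mem_filter]
      exact ⟨fun h => ⟨hW x hx y h, h⟩, fun h => h.2⟩
    · intro x _ hx
      simp [hφ x hx]
  have h2 : ∑ x ∈ W, ∑ y ∈ W, (if G.Adj x y then (φ y - φ x) * φ x else 0) =
      ∑ x ∈ W, ∑ y ∈ W, if G.Adj x y then (φ x - φ y) * φ y else 0 := by
    rw [Finset.sum_comm]
    simp only [G.adj_comm]
  have h3 : 2 * energy G W φ =
      ∑ x ∈ W, ∑ y ∈ W, if G.Adj x y then (φ x - φ y) ^ 2 else 0 := by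
    rw [energy, two_mul_sum_sym2 _ _ fun x => by simp [Set.indicator]]
    simp only [Set.indicator_apply, SimpleGraph.mem_edgeSet, sqIncr_mk]
  have h4 : (∑ x ∈ W, ∑ y ∈ W, if G.Adj x y then (φ y - φ x) * φ x else 0) +
      (∑ x ∈ W, ∑ y ∈ W, if G.Adj x y then (φ x - φ y) * φ y else 0) =
      - ∑ x ∈ W, ∑ y ∈ W, if G.Adj x y then (φ x - φ y) ^ 2 else 0 := by
    simp only [← Finset.sum_add_distrib, ← Finset.sum_neg_distrib]
    refine Finset.sum_congr rfl fun x _ => Finset.sum_congr rfl fun y _ => ?_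
    split_ifs <;> ring
  linarith

theorem rayleigh_eq {V : Type*} (G : SimpleGraph V)
    (hlf : ∀ x, (G.neighborSet x).Finite) (hdeg : ∀ x, (G.neighborSet x).Nonempty)
    {Λ W : Finset V} (hΛW : Λ ⊆ W) (hW : ∀ x ∈ Λ, ∀ y, G.Adj x y → y ∈ W)
    {φ : V → ℝ} (hφ : ∀ x ∉ Λ, φ x = 0) (q : V → ℝ) :
    ∑ x ∈ Λ, degR G x * (lapl G φ x + q x * φ x) * φ x =
      - energy G W φ + ∑ x ∈ Λ, q x * (degR G x * φ x ^ 2) := by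
  rw [← sum_lapl_mul_self G hlf hdeg hΛW hW hφ, ← Finset.sum_add_distrib]
  exact Finset.sum_congr rfl fun x _ => by ring

theorem dInner_self_eq {V : Type*} (G : SimpleGraph V) {Λ : Finset V} {φ : V → ℝ}
    (hφ : ∀ x ∉ Λ, φ x = 0) : dInner G φ φ = ∑ x ∈ Λ, degR G x * φ x ^ 2 := by
  rw [dInner, finsum_eq_sum_of_support_subset (s := Λ)]
  · exact Finset.sum_congr rfl fun x _ => by ring
  · intro x hx
    by_contra h
    exact hx (by simp [hφ x h])

theorem JV_eq {V : Type*} {Λ : Finset V} {p : V → ℝ} (hp : IsProb p)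
    (hpΛ : ∀ x ∉ Λ, p x = 0) :
    JV p = ENNReal.ofReal (∑ x ∈ Λ, -(p x * Real.log (p x))) := by
  rw [JV, tsum_eq_sum (s := Λ) fun x hx => by simp [hpΛ x hx], ENNReal.ofReal_sum_of_nonneg]
  intro x _
  exact neg_nonneg.2 (mul_nonpos_of_nonneg_of_nonpos (hp.1 x) (Real.log_nonpos (hp.1 x) (hp.2.1 x)))

theorem IsProb.sum_eq_one {V : Type*} {Λ : Finset V} {p : V → ℝ} (hp : IsProb p)
    (hpΛ : ∀ x ∉ Λ, p x = 0) : ∑ x ∈ Λ, p x = 1 :=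
  (hasSum_sum_of_ne_finset_zero hpΛ).unique hp.2.2

theorem isProb_of_sum_eq_one {V : Type*} {Λ : Finset V} {p : V → ℝ} (h0 : ∀ x, 0 ≤ p x)
    (hpΛ : ∀ x ∉ Λ, p x = 0) (h1 : ∑ x ∈ Λ, p x = 1) : IsProb p := by
  refine ⟨h0, fun x => ?_, h1 ▸ hasSum_sum_of_ne_finset_zero hpΛ⟩
  by_cases hx : x ∈ Λ
  · exact h1 ▸ Finset.single_le_sum (fun i _ => h0 i) hx
  · simp [hpΛ x hx]

/-- The Gibbs variational inequality. -/
theorem sum_mul_le_sum_mul_log {ι : Type*} (s : Finset ι) {p u : ι → ℝ}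
    (hp : ∀ i ∈ s, 0 ≤ p i) (hp1 : ∑ i ∈ s, p i = 1) (hu : ∑ i ∈ s, Real.exp (u i) ≤ 1) :
    ∑ i ∈ s, u i * p i ≤ ∑ i ∈ s, p i * Real.log (p i) := by
  have h : ∀ i ∈ s, u i * p i - p i * Real.log (p i) ≤ Real.exp (u i) - p i := by
    intro i hi
    rcases (hp i hi).eq_or_lt with h0 | h0
    · simp [← h0, (Real.exp_pos _).le]
    · have h2 := Real.add_one_le_exp (u i - Real.log (p i))
      rw [Real.exp_sub, Real.exp_log h0, le_div_iff₀ h0] at h2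
      linarith
  have := Finset.sum_le_sum h
  rw [Finset.sum_sub_distrib, Finset.sum_sub_distrib] at this
  linarith

/-- Near-optimal potentials in the Gibbs variational inequality. -/
theorem exists_sum_exp_le_one_and_le_sum_mul {ι : Type*} (s : Finset ι) {p : ι → ℝ}
    (hp : ∀ i ∈ s, 0 ≤ p i) (hp1 : ∑ i ∈ s, p i = 1) {ε : ℝ} (hε : 0 < ε) :
    ∃ u : ι → ℝ, ∑ i ∈ s, Real.exp (u i) ≤ 1 ∧
      ∑ i ∈ s, p i * Real.log (p i) - s.card * ε ≤ ∑ i ∈ s, u i * p i := by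
  have hn : 0 < 1 + s.card * ε := by positivity
  refine ⟨fun i => Real.log (p i + ε) - Real.log (1 + s.card * ε), ?_, ?_⟩
  · have : ∀ i ∈ s, Real.exp (Real.log (p i + ε) - Real.log (1 + s.card * ε)) =
        (p i + ε) / (1 + s.card * ε) := fun i hi => by
      rw [Real.exp_sub, Real.exp_log hn, Real.exp_log (by linarith [hp i hi])]
    rw [Finset.sum_congr rfl this, ← Finset.sum_div, Finset.sum_add_distrib, hp1,
      Finset.sum_const, nsmul_eq_mul, div_self hn.ne']
  · have hlog := Real.log_le_sub_one_of_pos hn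
    have h : ∀ i ∈ s, p i * Real.log (p i) - p i * (s.card * ε) ≤
        (Real.log (p i + ε) - Real.log (1 + s.card * ε)) * p i := by
      intro i hi
      rcases (hp i hi).eq_or_lt with h0 | h0
      · simp [← h0]
      · have := Real.log_le_log h0 (by linarith : p i ≤ p i + ε)
        nlinarith
    have := Finset.sum_le_sum h
    rwa [Finset.sum_sub_distrib, ← Finset.sum_mul, hp1, one_mul] at this

/-- dual representation of the constrained variational formula:
`inf { I_E(p) + ρ J_V(p) : supp(p) ⊆ Λ } = − sup { λ_Λ(q) : Σ_{x∈Λ} e^{q(x)/ρ} ≤ 1 }`. -/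
theorem chi_dual_representation {V : Type*} (G : SimpleGraph V)
    (hlf : ∀ x, (G.neighborSet x).Finite)
    (hdeg : ∀ x, (G.neighborSet x).Nonempty)
    (Λ : Finset V) (hΛ : Λ.Nonempty) (ρ : ℝ) (hρ : 0 < ρ) :
    (⨅ (p : V → ℝ) (_ : IsProb p ∧ ∀ x ∉ Λ, p x = 0),
        IE G p + ENNReal.ofReal ρ * JV p)
      = ENNReal.ofReal
          (- sSup { r | ∃ q : V → ℝ, (∑ x ∈ Λ, Real.exp (q x / ρ)) ≤ 1 ∧
              r = pev G Λ q }) := by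
  classical
  set W : Finset V := Λ ∪ Λ.biUnion fun x => (hlf x).toFinset with hWdef
  have hΛW : Λ ⊆ W := Finset.subset_union_left
  have hW : ∀ x ∈ Λ, ∀ y, G.Adj x y → y ∈ W := fun x hx y hxy =>
    Finset.mem_union_right _ (Finset.mem_biUnion.2 ⟨x, hx, by simpa using hxy⟩)
  have hd : ∀ x, 0 < degR G x := fun x => degR_pos (hlf x) (hdeg x)
  set F : (V → ℝ) → ℝ := fun p =>
    energy G W (fun x => √(p x / degR G x)) + ρ * ∑ x ∈ Λ, -(p x * Real.log (p x)) with hF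
  have hEnt : ∀ p : V → ℝ, IsProb p → 0 ≤ ∑ x ∈ Λ, -(p x * Real.log (p x)) := fun p hp =>
    Finset.sum_nonneg fun x _ => neg_nonneg.2
      (mul_nonpos_of_nonneg_of_nonpos (hp.1 x) (Real.log_nonpos (hp.1 x) (hp.2.1 x)))
  have hFnn : ∀ p : V → ℝ, IsProb p → 0 ≤ F p := fun p hp =>
    add_nonneg (energy_nonneg _ _ _) (mul_nonneg hρ.le (hEnt p hp))
  have hval : ∀ p : V → ℝ, IsProb p → (∀ x ∉ Λ, p x = 0) →
      IE G p + ENNReal.ofReal ρ * JV p = ENNReal.ofReal (F p) := fun p hp hpΛ => by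
    rw [IE_eq_energy G hΛW hW hpΛ, JV_eq hp hpΛ, ← ENNReal.ofReal_mul hρ.le,
      ← ENNReal.ofReal_add (energy_nonneg _ _ _) (mul_nonneg hρ.le (hEnt p hp))]
  have hupper : ∀ q φ : V → ℝ, ∑ x ∈ Λ, Real.exp (q x / ρ) ≤ 1 → (∀ x ∉ Λ, φ x = 0) →
      dInner G φ φ = 1 → ∃ p, IsProb p ∧ (∀ x ∉ Λ, p x = 0) ∧
        ∑ x ∈ Λ, degR G x * (lapl G φ x + q x * φ x) * φ x ≤ - F p := by
    intro q φ hq hφ hφ1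
    have hp0 : ∀ x, 0 ≤ degR G x * φ x ^ 2 := fun x => mul_nonneg (hd x).le (sq_nonneg _)
    have hpΛ : ∀ x ∉ Λ, degR G x * φ x ^ 2 = 0 := fun x hx => by simp [hφ x hx]
    have hp1 : ∑ x ∈ Λ, degR G x * φ x ^ 2 = 1 := by rw [← dInner_self_eq G hφ, hφ1]
    refine ⟨fun x => degR G x * φ x ^ 2, isProb_of_sum_eq_one hp0 hpΛ hp1, hpΛ, ?_⟩
    rw [rayleigh_eq G hlf hdeg hΛW hW hφ]
    have habs : (fun x => √(degR G x * φ x ^ 2 / degR G x)) = fun x => |φ x| := by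
      funext x
      rw [mul_div_cancel_left₀ _ (hd x).ne', Real.sqrt_sq_eq_abs]
    have hE := energy_abs_le G W φ
    have hG := mul_le_mul_of_nonneg_left
      (sum_mul_le_sum_mul_log Λ (fun x _ => hp0 x) hp1 hq) hρ.le
    have hqρ : ρ * ∑ x ∈ Λ, q x / ρ * (degR G x * φ x ^ 2) =
        ∑ x ∈ Λ, q x * (degR G x * φ x ^ 2) := by
      rw [Finset.mul_sum]
      exact Finset.sum_congr rfl fun x _ => by field_simp
    simp only [hF, habs, Finset.sum_neg_distrib]
    linarith
  have hbdd : ∀ q : V → ℝ, ∑ x ∈ Λ, Real.exp (q x / ρ) ≤ 1 →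
      ∀ r ∈ { r | ∃ φ : V → ℝ, (∀ x ∉ Λ, φ x = 0) ∧ dInner G φ φ = 1 ∧
        r = ∑ x ∈ Λ, degR G x * (lapl G φ x + q x * φ x) * φ x }, r ≤ 0 := by
    rintro q hq r ⟨φ, hφ, hφ1, rfl⟩
    obtain ⟨p, hp, -, h⟩ := hupper q φ hq hφ hφ1
    linarith [hFnn p hp]
  have hlower : ∀ p : V → ℝ, IsProb p → (∀ x ∉ Λ, p x = 0) → ∀ q : V → ℝ,
      - energy G W (fun x => √(p x / degR G x)) + ∑ x ∈ Λ, q x * p x ∈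
        { r | ∃ φ : V → ℝ, (∀ x ∉ Λ, φ x = 0) ∧ dInner G φ φ = 1 ∧
          r = ∑ x ∈ Λ, degR G x * (lapl G φ x + q x * φ x) * φ x } := by
    intro p hp hpΛ q
    have hφ : ∀ x ∉ Λ, √(p x / degR G x) = 0 := fun x hx => by simp [hpΛ x hx]
    have hsq : ∀ x, degR G x * √(p x / degR G x) ^ 2 = p x := fun x => by
      rw [Real.sq_sqrt (div_nonneg (hp.1 x) (hd x).le), mul_div_cancel₀ _ (hd x).ne']
    refine ⟨fun x => √(p x / degR G x), hφ, ?_, ?_⟩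
    · rw [dInner_self_eq G hφ]
      simp only [hsq, hp.sum_eq_one hpΛ]
    · rw [rayleigh_eq G hlf hdeg hΛW hW hφ]
      simp only [hsq]
  set S := { r | ∃ q : V → ℝ, (∑ x ∈ Λ, Real.exp (q x / ρ)) ≤ 1 ∧ r = pev G Λ q } with hS
  have hSbdd : BddAbove S := by
    refine ⟨0, ?_⟩
    rintro r ⟨q, hq, rfl⟩
    exact Real.sSup_nonpos (hbdd q hq)
  have hSF : ∀ p : V → ℝ, IsProb p → (∀ x ∉ Λ, p x = 0) → ∀ ε > 0,
      ∃ r ∈ S, - F p - ρ * (Λ.card * ε) ≤ r := by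
    intro p hp hpΛ ε hε
    obtain ⟨u, hu, hle⟩ := exists_sum_exp_le_one_and_le_sum_mul Λ (fun x _ => hp.1 x)
      (hp.sum_eq_one hpΛ) hε
    have hq : ∑ x ∈ Λ, Real.exp (ρ * u x / ρ) ≤ 1 := by
      simpa only [mul_div_cancel_left₀ _ hρ.ne'] using hu
    refine ⟨_, ⟨fun x => ρ * u x, hq, rfl⟩, ?_⟩
    refine le_trans ?_ (le_csSup ⟨0, hbdd _ hq⟩ (hlower p hp hpΛ fun x => ρ * u x))
    have := mul_le_mul_of_nonneg_left hle hρ.le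
    simp only [hF, Finset.sum_neg_distrib, mul_assoc, ← Finset.mul_sum]
    linarith
  obtain ⟨x₀, hx₀⟩ := hΛ
  have hp₀Λ : ∀ x ∉ Λ, (Pi.single x₀ 1 : V → ℝ) x = 0 := fun x hx =>
    Pi.single_eq_of_ne (fun h : x = x₀ => hx (h ▸ hx₀)) _
  have hp₀ : IsProb (Pi.single x₀ 1 : V → ℝ) := by
    refine isProb_of_sum_eq_one (fun x => ?_) hp₀Λ (by simp [Finset.sum_pi_single', hx₀])
    by_cases h : x = x₀
    · subst h; simp
    · simp [h]
  apply le_antisymm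
  · set m := ⨅ (p : V → ℝ) (_ : IsProb p ∧ ∀ x ∉ Λ, p x = 0), IE G p + ENNReal.ofReal ρ * JV p
      with hm
    have hmF : ∀ p : V → ℝ, IsProb p → (∀ x ∉ Λ, p x = 0) → m ≤ ENNReal.ofReal (F p) :=
      fun p hp hpΛ => hval p hp hpΛ ▸ iInf₂_le p ⟨hp, hpΛ⟩
    have hmtop : m ≠ ⊤ := ne_top_of_le_ne_top ENNReal.ofReal_ne_top (hmF _ hp₀ hp₀Λ)
    rw [← ENNReal.ofReal_toReal hmtop]
    apply ENNReal.ofReal_le_ofReal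
    rw [le_neg]
    obtain ⟨r₀, hr₀, -⟩ := hSF _ hp₀ hp₀Λ 1 one_pos
    refine csSup_le ⟨r₀, hr₀⟩ ?_
    rintro _ ⟨q, hq, rfl⟩
    refine csSup_le ⟨_, hlower _ hp₀ hp₀Λ q⟩ ?_
    rintro _ ⟨φ, hφ, hφ1, rfl⟩
    obtain ⟨p, hp, hpΛ, h⟩ := hupper q φ hq hφ hφ1
    exact h.trans (neg_le_neg (ENNReal.toReal_le_of_le_ofReal (hFnn p hp) (hmF p hp hpΛ)))
  · refine le_iInf₂ fun p hp => ?_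
    rw [hval p hp.1 hp.2]
    apply ENNReal.ofReal_le_ofReal
    rw [neg_le]
    refine le_of_forall_pos_sub_le fun δ hδ => ?_
    have hc : (0 : ℝ) < Λ.card := by exact_mod_cast Finset.card_pos.2 ⟨x₀, hx₀⟩
    obtain ⟨r, hr, hle⟩ := hSF p hp.1 hp.2 (δ / (ρ * Λ.card)) (by positivity)
    have hδeq : ρ * (Λ.card * (δ / (ρ * Λ.card))) = δ := by field_simp
    rw [hδeq] at hle
    exact hle.trans (le_csSup hSbdd hr)
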